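/- arXiv:0901.2533 — 2 statements merged into one kernel-verified Lean document; each statement's English description precedes it below -/
import Mathlib

section
/- There exist constants c, C > 0 such that for every r > 0 and every u ∈ Ḣ^{1/2}(ℝ): c · Σ_{j∈ℤ} ‖u‖²_{Ḣ^{1/2}(A_j^r)} ≤ ‖u‖²_{Ḣ^{1/2}(ℝ)} ≤ C · Σ_{j∈ℤ} ‖u‖²_{Ḣ^{1/2}(A_j^r)}, where A_j^r = B_{2^{j+1}r} \ B_{2^{j-1}r}; the constants c, C do not depend on r. -/
noncomputable section
open MeasureTheory Real Set
open scoped ENNReal NNReal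

/-- The squared Gagliardo `Ḣ^{1/2}` seminorm on a set `Ω ⊆ ℝ`. -/
def gagE (Ω : Set ℝ) (u : ℝ → ℝ) : ℝ≥0∞ :=
  ∫⁻ x in Ω, ∫⁻ y in Ω, ENNReal.ofReal ((u x - u y) ^ 2 / |x - y| ^ 2)

/-- `B_ρ = (−ρ, ρ) ⊂ ℝ`. -/
def ballR (ρ : ℝ) : Set ℝ := Set.Ioo (-ρ) ρ

/-- The dyadic annulus `A_j^r = B_{2^{j+1} r} \ B_{2^{j-1} r}`. -/
def annr (r : ℝ) (j : ℤ) : Set ℝ :=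
  ballR ((2 : ℝ) ^ (j + 1) * r) \ ballR ((2 : ℝ) ^ (j - 1) * r)

/-- The measure on `ℝ × ℝ` whose density is the Gagliardo kernel of `u`. -/
def gagMeasure (u : ℝ → ℝ) : Measure (ℝ × ℝ) :=
  ((volume : Measure ℝ).prod volume).withDensity
    fun p => ENNReal.ofReal ((u p.1 - u p.2) ^ 2 / |p.1 - p.2| ^ 2)

/-- The dyadic shell `B_{2^{j+1} r} \ B_{2^j r}`. -/
def shell (r : ℝ) (j : ℤ) : Set ℝ :=
  {x | (2 : ℝ) ^ j * r ≤ |x| ∧ |x| < (2 : ℝ) ^ (j + 1) * r}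

/-- The normalized Lebesgue measure on a dyadic shell. -/
def shellMeasure (r : ℝ) (j : ℤ) : Measure ℝ :=
  (volume (shell r j))⁻¹ • volume.restrict (shell r j)

/-- The mean square difference of `u` between points distributed according to `μ` and `ν`. -/
def meanSqDiff (u : ℝ → ℝ) (μ ν : Measure ℝ) : ℝ≥0∞ :=
  ∫⁻ x, ∫⁻ y, ENNReal.ofReal ((u x - u y) ^ 2) ∂ν ∂μ

lemma measurable_gagKernel {u : ℝ → ℝ} (hu : Measurable u) :
    Measurable fun p : ℝ × ℝ =>
      ENNReal.ofReal ((u p.1 - u p.2) ^ 2 / |p.1 - p.2| ^ 2) := by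
  fun_prop

lemma measurable_sqDiff {u : ℝ → ℝ} (hu : Measurable u) :
    Measurable fun p : ℝ × ℝ => ENNReal.ofReal ((u p.1 - u p.2) ^ 2) := by
  fun_prop

lemma gagMeasure_prod {u : ℝ → ℝ} (hu : Measurable u) {A B : Set ℝ}
    (hA : MeasurableSet A) (hB : MeasurableSet B) :
    gagMeasure u (A ×ˢ B) =
      ∫⁻ x in A, ∫⁻ y in B, ENNReal.ofReal ((u x - u y) ^ 2 / |x - y| ^ 2) := by
  rw [gagMeasure, withDensity_apply _ (hA.prod hB), ← Measure.prod_restrict,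
    lintegral_prod _ (measurable_gagKernel hu).aemeasurable]

lemma gagE_eq_gagMeasure {u : ℝ → ℝ} (hu : Measurable u) {A : Set ℝ}
    (hA : MeasurableSet A) : gagE A u = gagMeasure u (A ×ˢ A) :=
  (gagMeasure_prod hu hA hA).symm

lemma gagMeasure_prod_comm {u : ℝ → ℝ} (hu : Measurable u) {A B : Set ℝ}
    (hA : MeasurableSet A) (hB : MeasurableSet B) :
    gagMeasure u (A ×ˢ B) = gagMeasure u (B ×ˢ A) := by
  rw [gagMeasure_prod hu hA hB, gagMeasure_prod hu hB hA,
    lintegral_lintegral_swap (measurable_gagKernel hu).aemeasurable]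
  refine lintegral_congr fun y => lintegral_congr fun x => ?_
  rw [abs_sub_comm x y, sub_sq_comm]

lemma gagE_congr_ae {u v : ℝ → ℝ} (h : u =ᵐ[volume] v) (A : Set ℝ) :
    gagE A u = gagE A v := by
  have h' : ∀ᵐ x ∂(volume.restrict A), u x = v x := ae_restrict_of_ae h
  unfold gagE
  refine lintegral_congr_ae ?_
  filter_upwards [h'] with x hx
  refine lintegral_congr_ae ?_
  filter_upwards [h'] with y hy
  rw [hx, hy]

lemma measurableSet_shell (r : ℝ) (j : ℤ) : MeasurableSet (shell r j) :=
  (measurableSet_le measurable_const measurable_id.abs).inter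
    (measurableSet_lt measurable_id.abs measurable_const)

lemma annr_eq_union {r : ℝ} (hr : 0 < r) (j : ℤ) :
    annr r j = shell r (j - 1) ∪ shell r j := by
  have h1 : (2 : ℝ) ^ (j - 1) * r ≤ 2 ^ j * r := by
    gcongr
    · norm_num
    · omega
  have h2 : (2 : ℝ) ^ j * r ≤ 2 ^ (j + 1) * r := by
    gcongr
    · norm_num
    · omega
  ext x
  simp only [annr, ballR, shell, mem_sdiff, mem_Ioo, ← abs_lt, not_lt, mem_union, mem_ofPred_eq,
    sub_add_cancel]
  constructor
  · rintro ⟨ha, hb⟩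
    rcases lt_or_ge |x| ((2 : ℝ) ^ j * r) with h | h
    · exact Or.inl ⟨hb, h⟩
    · exact Or.inr ⟨h, ha⟩
  · rintro (⟨ha, hb⟩ | ⟨ha, hb⟩)
    · exact ⟨hb.trans_le h2, ha⟩
    · exact ⟨hb, h1.trans ha⟩

lemma measurableSet_annr (r : ℝ) (j : ℤ) : MeasurableSet (annr r j) :=
  measurableSet_Ioo.diff measurableSet_Ioo

lemma disjoint_shell {r : ℝ} (hr : 0 < r) {j k : ℤ} (hjk : j ≠ k) :
    Disjoint (shell r j) (shell r k) := by
  wlog h : j < k generalizing j k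
  · exact (this hjk.symm (by omega)).symm
  refine Set.disjoint_left.2 fun x hx hy => ?_
  have h1 : (2 : ℝ) ^ (j + 1) * r ≤ 2 ^ k * r := by
    gcongr
    · norm_num
    · omega
  exact absurd (hx.2.trans_le (h1.trans hy.1)) (lt_irrefl _)

lemma iUnion_shell {r : ℝ} (hr : 0 < r) : ⋃ j, shell r j = {0}ᶜ := by
  ext x
  simp only [mem_iUnion, mem_compl_iff, mem_singleton_iff]
  constructor
  · rintro ⟨j, hj⟩ rfl
    have : (0 : ℝ) < 2 ^ j * r := by positivity
    exact absurd hj.1 (by simpa using this)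
  · intro hx
    obtain ⟨j, h1, h2⟩ := exists_mem_Ico_zpow (x := |x| / r) (y := 2)
      (by positivity) (by norm_num)
    exact ⟨j, (le_div_iff₀ hr).1 h1, (div_lt_iff₀ hr).1 h2⟩

lemma volume_shell {r : ℝ} (hr : 0 < r) (j : ℤ) :
    volume (shell r j) = ENNReal.ofReal (2 ^ (j + 1) * r) := by
  have hp : (0 : ℝ) < 2 ^ j * r := by positivity
  have h2 : (2 : ℝ) ^ (j + 1) * r = 2 * (2 ^ j * r) := by
    rw [zpow_add_one₀ two_ne_zero]; ring
  have hs : shell r j =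
      Ioc (-(2 ^ (j + 1) * r)) (-(2 ^ j * r)) ∪ Ico (2 ^ j * r) (2 ^ (j + 1) * r) := by
    ext x
    simp only [shell, mem_ofPred_eq, mem_union, mem_Ioc, mem_Ico, abs_lt, le_abs]
    constructor
    · rintro ⟨h | h, h3, h4⟩
      · exact Or.inr ⟨h, h4⟩
      · exact Or.inl ⟨h3, by linarith⟩
    · rintro (⟨h3, h4⟩ | ⟨h3, h4⟩)
      · exact ⟨Or.inr (by linarith), h3, by linarith⟩
      · exact ⟨Or.inl h3, by linarith, h4⟩
  rw [hs, measure_union _ measurableSet_Ico, Real.volume_Ioc, Real.volume_Ico,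
    ← ENNReal.ofReal_add (by linarith) (by linarith)]
  · congr 1
    linarith
  · exact Set.disjoint_left.2 fun x h3 h4 => by linarith [h3.2, h4.1]

lemma gagMeasure_univ {u : ℝ → ℝ} {r : ℝ} (hr : 0 < r) :
    gagMeasure u univ = ∑' p : ℤ × ℤ, gagMeasure u (shell r p.1 ×ˢ shell r p.2) := by
  have hae : (univ : Set (ℝ × ℝ)) =ᵐ[gagMeasure u] ⋃ p : ℤ × ℤ, shell r p.1 ×ˢ shell r p.2 := by
    refine (withDensity_absolutelyContinuous _ _).ae_eq ?_
    have h0 : ({0}ᶜ : Set ℝ) =ᵐ[volume] univ := by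
      rw [ae_eq_univ, compl_compl]; simp
    have h1 := Measure.set_prod_ae_eq h0 h0
    rw [univ_prod_univ, ← iUnion_shell hr, ← Set.iUnion_prod] at h1
    exact h1.symm
  rw [measure_congr hae, measure_iUnion]
  · intro p q hpq
    refine Set.disjoint_prod.2 ?_
    by_cases h : p.1 = q.1
    · exact Or.inr (disjoint_shell hr fun h' => hpq (Prod.ext h h'))
    · exact Or.inl (disjoint_shell hr h)
  · exact fun p => (measurableSet_shell r _).prod (measurableSet_shell r _)

lemma tsum_gagE_annr_le {u : ℝ → ℝ} (hu : Measurable u) {r : ℝ} (hr : 0 < r) :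
    ∑' j : ℤ, gagE (annr r j) u ≤ 2 * gagE univ u := by
  have key : ∑' j : ℤ, gagMeasure u (shell r j ×ˢ univ) ≤ gagE univ u := by
    rw [gagE_eq_gagMeasure hu .univ, univ_prod_univ, ← measure_iUnion]
    · exact measure_mono (subset_univ _)
    · exact fun j k hjk => Set.disjoint_prod.2 (Or.inl (disjoint_shell hr hjk))
    · exact fun j => (measurableSet_shell r _).prod .univ
  have hshift : ∑' j : ℤ, gagMeasure u (shell r (j - 1) ×ˢ univ) ≤ gagE univ u :=
    ((Equiv.subRight (1 : ℤ)).tsum_eq fun j => gagMeasure u (shell r j ×ˢ univ)).trans_le key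
  rw [two_mul]
  refine le_trans ?_ (add_le_add hshift key)
  rw [← ENNReal.tsum_add]
  refine ENNReal.tsum_le_tsum fun j => ?_
  rw [gagE_eq_gagMeasure hu (measurableSet_annr r _), annr_eq_union hr]
  refine (measure_mono (prod_mono_right (subset_univ _))).trans ?_
  rw [union_prod]
  exact measure_union_le _ _

lemma gagMeasure_diag_le {u : ℝ → ℝ} (hu : Measurable u) {r : ℝ} (hr : 0 < r) :
    ∑' j : ℤ, gagMeasure u (shell r j ×ˢ shell r (j + 0)) ≤ ∑' j : ℤ, gagE (annr r j) u := by
  refine ENNReal.tsum_le_tsum fun j => ?_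
  rw [gagE_eq_gagMeasure hu (measurableSet_annr r _), annr_eq_union hr, add_zero]
  exact measure_mono (prod_mono subset_union_right subset_union_right)

lemma gagMeasure_succ_le {u : ℝ → ℝ} (hu : Measurable u) {r : ℝ} (hr : 0 < r) :
    ∑' j : ℤ, gagMeasure u (shell r j ×ˢ shell r (j + 1)) ≤ ∑' j : ℤ, gagE (annr r j) u := by
  rw [← (Equiv.addRight (1 : ℤ)).tsum_eq fun j => gagE (annr r j) u]
  refine ENNReal.tsum_le_tsum fun j => ?_
  rw [gagE_eq_gagMeasure hu (measurableSet_annr r _), Equiv.coe_addRight, annr_eq_union hr,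
    add_sub_cancel_right]
  exact measure_mono (prod_mono subset_union_left subset_union_right)

lemma isProbabilityMeasure_shellMeasure {r : ℝ} (hr : 0 < r) (j : ℤ) :
    IsProbabilityMeasure (shellMeasure r j) := by
  constructor
  have hp : (0 : ℝ) < 2 ^ (j + 1) * r := by positivity
  rw [shellMeasure, Measure.smul_apply, Measure.restrict_apply_univ, smul_eq_mul]
  exact ENNReal.inv_mul_cancel (by simpa [volume_shell hr] using hp) (by simp [volume_shell hr])

lemma meanSqDiff_triangle {u : ℝ → ℝ} (hu : Measurable u) (μ₁ μ₂ μ₃ : Measure ℝ)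
    [IsProbabilityMeasure μ₁] [IsProbabilityMeasure μ₂] [IsProbabilityMeasure μ₃] :
    meanSqDiff u μ₁ μ₃ ≤
      ENNReal.ofReal (3 / 2) * meanSqDiff u μ₁ μ₂ + 3 * meanSqDiff u μ₂ μ₃ := by
  set F : ℝ → ℝ → ℝ≥0∞ := fun x y => ENNReal.ofReal ((u x - u y) ^ 2) with hF
  have hm : Measurable (Function.uncurry F) := measurable_sqDiff hu
  have hpt : ∀ x z y, F x y ≤ ENNReal.ofReal (3 / 2) * F x z + 3 * F z y := by
    intro x z y
    have h3 : (3 : ℝ≥0∞) = ENNReal.ofReal 3 := by simp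
    simp only [hF]
    rw [h3, ← ENNReal.ofReal_mul (by norm_num), ← ENNReal.ofReal_mul (by norm_num),
      ← ENNReal.ofReal_add (by positivity) (by positivity)]
    refine ENNReal.ofReal_le_ofReal ?_
    nlinarith [sq_nonneg ((u x - u z) - 2 * (u z - u y))]
  have hx : ∀ x, Measurable (F x) := fun x => hm.of_uncurry_left
  have hz : Measurable fun z => ∫⁻ y, F z y ∂μ₃ := hm.lintegral_prod_right'
  have hz2 : Measurable fun z => ∫⁻ y, F z y ∂μ₂ := hm.lintegral_prod_right'
  have hxz : ∀ x z, ∫⁻ y, F x y ∂μ₃ ≤ ENNReal.ofReal (3 / 2) * F x z + 3 * ∫⁻ y, F z y ∂μ₃ := by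
    intro x z
    calc ∫⁻ y, F x y ∂μ₃ ≤ ∫⁻ y, (ENNReal.ofReal (3 / 2) * F x z + 3 * F z y) ∂μ₃ :=
          lintegral_mono (hpt x z)
      _ = _ := by
          rw [lintegral_add_left measurable_const, lintegral_const, measure_univ, mul_one,
            lintegral_const_mul _ (hx z)]
  have hx' : ∀ x, ∫⁻ y, F x y ∂μ₃ ≤
      ENNReal.ofReal (3 / 2) * ∫⁻ z, F x z ∂μ₂ + 3 * meanSqDiff u μ₂ μ₃ := by
    intro x
    calc ∫⁻ y, F x y ∂μ₃ = ∫⁻ _z, ∫⁻ y, F x y ∂μ₃ ∂μ₂ := by simp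
      _ ≤ ∫⁻ z, (ENNReal.ofReal (3 / 2) * F x z + 3 * ∫⁻ y, F z y ∂μ₃) ∂μ₂ :=
          lintegral_mono (hxz x)
      _ = _ := by
          rw [lintegral_add_left ((hx x).const_mul _), lintegral_const_mul _ (hx x),
            lintegral_const_mul _ hz]
          rfl
  calc meanSqDiff u μ₁ μ₃ = ∫⁻ x, ∫⁻ y, F x y ∂μ₃ ∂μ₁ := rfl
    _ ≤ ∫⁻ x, (ENNReal.ofReal (3 / 2) * ∫⁻ z, F x z ∂μ₂ + 3 * meanSqDiff u μ₂ μ₃) ∂μ₁ :=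
        lintegral_mono hx'
    _ = _ := by
        rw [lintegral_add_right _ measurable_const, lintegral_const, measure_univ, mul_one,
          lintegral_const_mul _ hz2]
        rfl

lemma tsum_meanSqDiff_le {u : ℝ → ℝ} (hu : Measurable u) {r : ℝ} (hr : 0 < r) (n : ℕ) :
    ∑' j : ℤ, meanSqDiff u (shellMeasure r j) (shellMeasure r (j + (n + 1 : ℕ))) +
        6 * ∑' j : ℤ, meanSqDiff u (shellMeasure r j) (shellMeasure r (j + 1)) ≤
      6 * ENNReal.ofReal (3 / 2) ^ (n + 1) *
        ∑' j : ℤ, meanSqDiff u (shellMeasure r j) (shellMeasure r (j + 1)) := by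
  have := isProbabilityMeasure_shellMeasure hr
  set Q := ∑' j : ℤ, meanSqDiff u (shellMeasure r j) (shellMeasure r (j + 1)) with hQ
  have h32 : 6 * ENNReal.ofReal (3 / 2) = 9 := by
    rw [show (6 : ℝ≥0∞) = ENNReal.ofReal 6 by simp, ← ENNReal.ofReal_mul (by norm_num)]
    norm_num
  induction n with
  | zero =>
    rw [zero_add, pow_one, h32, Nat.cast_one, ← hQ]
    calc Q + 6 * Q = 7 * Q := by ring
      _ ≤ 9 * Q := by gcongr; norm_num
  | succ n ih =>
    have hs : ∑' j : ℤ, meanSqDiff u (shellMeasure r (j + (n + 1 : ℕ)))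
        (shellMeasure r (j + (n + 1 : ℕ) + 1)) = Q :=
      (Equiv.addRight ((n + 1 : ℕ) : ℤ)).tsum_eq fun j =>
        meanSqDiff u (shellMeasure r j) (shellMeasure r (j + 1))
    have hstep : ∑' j : ℤ, meanSqDiff u (shellMeasure r j) (shellMeasure r (j + (n + 1 + 1 : ℕ))) ≤
        ENNReal.ofReal (3 / 2) *
          ∑' j : ℤ, meanSqDiff u (shellMeasure r j) (shellMeasure r (j + (n + 1 : ℕ))) + 3 * Q := by
      rw [← hs, ← ENNReal.tsum_mul_left, ← ENNReal.tsum_mul_left, ← ENNReal.tsum_add]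
      refine ENNReal.tsum_le_tsum fun j => ?_
      rw [Nat.cast_add (n + 1) 1, Nat.cast_one, ← add_assoc]
      exact meanSqDiff_triangle hu _ _ _
    calc _ ≤ ENNReal.ofReal (3 / 2) * ∑' j : ℤ,
            meanSqDiff u (shellMeasure r j) (shellMeasure r (j + (n + 1 : ℕ))) + 3 * Q + 6 * Q := by
          gcongr
      _ = ENNReal.ofReal (3 / 2) * (∑' j : ℤ,
            meanSqDiff u (shellMeasure r j) (shellMeasure r (j + (n + 1 : ℕ)))) +
            (6 * ENNReal.ofReal (3 / 2)) * Q := by rw [h32]; ring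
      _ = ENNReal.ofReal (3 / 2) * (∑' j : ℤ,
            meanSqDiff u (shellMeasure r j) (shellMeasure r (j + (n + 1 : ℕ))) + 6 * Q) := by ring
      _ ≤ ENNReal.ofReal (3 / 2) * (6 * ENNReal.ofReal (3 / 2) ^ (n + 1) * Q) := by gcongr
      _ = _ := by ring

lemma meanSqDiff_shellMeasure (u : ℝ → ℝ) (hu : Measurable u) {r : ℝ} (hr : 0 < r) (j k : ℤ) :
    meanSqDiff u (shellMeasure r j) (shellMeasure r k) =
      ENNReal.ofReal (2 ^ (j + 1) * r * (2 ^ (k + 1) * r))⁻¹ *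
        ∫⁻ x in shell r j, ∫⁻ y in shell r k, ENNReal.ofReal ((u x - u y) ^ 2) := by
  have hm : Measurable fun x => ∫⁻ y in shell r k, ENNReal.ofReal ((u x - u y) ^ 2) :=
    (measurable_sqDiff hu).lintegral_prod_right'
  simp only [meanSqDiff, shellMeasure, lintegral_smul_measure, smul_eq_mul]
  rw [lintegral_const_mul _ hm, ← mul_assoc, volume_shell hr, volume_shell hr,
    ← ENNReal.ofReal_inv_of_pos (by positivity), ← ENNReal.ofReal_inv_of_pos (by positivity),
    ← ENNReal.ofReal_mul (by positivity), ← mul_inv]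

lemma meanSqDiff_succ_le {u : ℝ → ℝ} (hu : Measurable u) {r : ℝ} (hr : 0 < r) (j : ℤ) :
    meanSqDiff u (shellMeasure r j) (shellMeasure r (j + 1)) ≤
      5 * gagMeasure u (shell r j ×ˢ shell r (j + 1)) := by
  have hp : (0 : ℝ) < 2 ^ j * r := by positivity
  have h1 : (2 : ℝ) ^ (j + 1) * r = 2 * (2 ^ j * r) := by
    rw [zpow_add_one₀ two_ne_zero]; ring
  have h2 : (2 : ℝ) ^ (j + 1 + 1) * r = 4 * (2 ^ j * r) := by
    rw [zpow_add_one₀ two_ne_zero, zpow_add_one₀ two_ne_zero]; ring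
  rw [meanSqDiff_shellMeasure u hu hr, gagMeasure_prod hu (measurableSet_shell r _)
    (measurableSet_shell r _), h1, h2]
  set ρ := (2 : ℝ) ^ j * r with hρ
  have hm : Measurable fun x => ∫⁻ y in shell r (j + 1),
      ENNReal.ofReal ((u x - u y) ^ 2 / |x - y| ^ 2) :=
    (measurable_gagKernel hu).lintegral_prod_right'
  have hle : ∫⁻ x in shell r j, ∫⁻ y in shell r (j + 1), ENNReal.ofReal ((u x - u y) ^ 2) ≤
      ENNReal.ofReal (36 * ρ ^ 2) * ∫⁻ x in shell r j, ∫⁻ y in shell r (j + 1),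
        ENNReal.ofReal ((u x - u y) ^ 2 / |x - y| ^ 2) := by
    rw [← lintegral_const_mul _ hm]
    refine setLIntegral_mono' (measurableSet_shell r _) fun x hx => ?_
    have hmx : Measurable fun y => ENNReal.ofReal ((u x - u y) ^ 2 / |x - y| ^ 2) := by fun_prop
    rw [← lintegral_const_mul _ hmx]
    refine setLIntegral_mono' (measurableSet_shell r _) fun y hy => ?_
    rw [← ENNReal.ofReal_mul (by positivity)]
    refine ENNReal.ofReal_le_ofReal ?_
    have hxy : |x - y| ≤ 6 * ρ := by
      have := abs_sub x y
      linarith [hx.2, hy.2]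
    rcases eq_or_ne x y with rfl | hne
    · simp
    · have hpos : 0 < |x - y| := abs_pos.2 (sub_ne_zero.2 hne)
      rw [mul_div_assoc', le_div_iff₀ (by positivity), mul_comm]
      gcongr
      nlinarith
  refine (mul_le_mul_right hle _).trans ?_
  rw [← mul_assoc, ← ENNReal.ofReal_mul (by positivity),
    show (5 : ℝ≥0∞) = ENNReal.ofReal 5 by simp]
  gcongr
  rw [inv_mul_le_iff₀ (by positivity)]
  nlinarith

lemma gagMeasure_shell_le {u : ℝ → ℝ} (hu : Measurable u) {r : ℝ} (hr : 0 < r) (j : ℤ) {n : ℕ}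
    (hn : 2 ≤ n) :
    gagMeasure u (shell r j ×ˢ shell r (j + n)) ≤
      16 * ENNReal.ofReal (1 / 2) ^ n *
        meanSqDiff u (shellMeasure r j) (shellMeasure r (j + n)) := by
  have hp : (0 : ℝ) < 2 ^ j * r := by positivity
  have h1 : (2 : ℝ) ^ (j + 1) * r = 2 * (2 ^ j * r) := by
    rw [zpow_add_one₀ two_ne_zero]; ring
  have h0 : (2 : ℝ) ^ (j + n) * r = 2 ^ n * (2 ^ j * r) := by
    rw [zpow_add₀ two_ne_zero, zpow_natCast]; ring
  have h2 : (2 : ℝ) ^ (j + n + 1) * r = 2 * 2 ^ n * (2 ^ j * r) := by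
    rw [zpow_add_one₀ two_ne_zero, zpow_add₀ two_ne_zero, zpow_natCast]; ring
  have hN : (4 : ℝ) ≤ 2 ^ n := by
    calc (4 : ℝ) = 2 ^ 2 := by norm_num
      _ ≤ 2 ^ n := by gcongr; norm_num
  rw [meanSqDiff_shellMeasure u hu hr, gagMeasure_prod hu (measurableSet_shell r _)
    (measurableSet_shell r _), h1, h2]
  have hmF : Measurable fun x => ∫⁻ y in shell r (j + n), ENNReal.ofReal ((u x - u y) ^ 2) :=
    (measurable_sqDiff hu).lintegral_prod_right'
  set ρ := (2 : ℝ) ^ j * r with hρ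
  set N := (2 : ℝ) ^ n with hNdef
  have hle : ∫⁻ x in shell r j, ∫⁻ y in shell r (j + n),
        ENNReal.ofReal ((u x - u y) ^ 2 / |x - y| ^ 2) ≤
      ENNReal.ofReal (4 / (N * ρ) ^ 2) * ∫⁻ x in shell r j, ∫⁻ y in shell r (j + n),
        ENNReal.ofReal ((u x - u y) ^ 2) := by
    rw [← lintegral_const_mul _ hmF]
    refine setLIntegral_mono' (measurableSet_shell r _) fun x hx => ?_
    have hmx : Measurable fun y => ENNReal.ofReal ((u x - u y) ^ 2) := by fun_prop
    rw [← lintegral_const_mul _ hmx]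
    refine setLIntegral_mono' (measurableSet_shell r _) fun y hy => ?_
    rw [← ENNReal.ofReal_mul (by positivity)]
    refine ENNReal.ofReal_le_ofReal ?_
    have hxy : N * ρ / 2 ≤ |x - y| := by
      have h3 := abs_sub_abs_le_abs_sub y x
      rw [abs_sub_comm] at h3
      have h4 := hx.2
      have h5 := hy.1
      rw [h1] at h4
      rw [h0] at h5
      nlinarith
    have hNρ : 0 < N * ρ := by positivity
    calc (u x - u y) ^ 2 / |x - y| ^ 2 ≤ (u x - u y) ^ 2 / (N * ρ / 2) ^ 2 := by gcongr
      _ = _ := by field_simp; norm_num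
  refine hle.trans (le_of_eq ?_)
  rw [← mul_assoc (_ * _ : ℝ≥0∞), ← ENNReal.ofReal_pow (by norm_num), show (16 : ℝ≥0∞) = ENNReal.ofReal 16 by simp,
    ← ENNReal.ofReal_mul (by norm_num), ← ENNReal.ofReal_mul (by positivity)]
  congr 2
  rw [one_div, inv_pow, ← hNdef]
  field_simp
  norm_num

lemma tsum_gagMeasure_shell_le {u : ℝ → ℝ} (hu : Measurable u) {r : ℝ} (hr : 0 < r) (n : ℕ) :
    ∑' j : ℤ, gagMeasure u (shell r j ×ˢ shell r (j + n)) ≤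
      ENNReal.ofReal (480 * (3 / 4) ^ n) * ∑' j : ℤ, gagE (annr r j) u := by
  set G := ∑' j : ℤ, gagE (annr r j) u with hG
  match n with
  | 0 =>
    refine (gagMeasure_diag_le hu hr).trans (le_mul_of_one_le_left' ?_)
    simp
  | 1 =>
    refine (by simpa using gagMeasure_succ_le hu hr : _ ≤ G).trans (le_mul_of_one_le_left' ?_)
    rw [ENNReal.one_le_ofReal]
    norm_num
  | n + 2 =>
    have hQ : ∑' j : ℤ, meanSqDiff u (shellMeasure r j) (shellMeasure r (j + 1)) ≤ 5 * G := by
      refine (ENNReal.tsum_le_tsum fun j => meanSqDiff_succ_le hu hr j).trans ?_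
      rw [ENNReal.tsum_mul_left]
      gcongr
      exact gagMeasure_succ_le hu hr
    calc _ ≤ ∑' j : ℤ, 16 * ENNReal.ofReal (1 / 2) ^ (n + 2) *
            meanSqDiff u (shellMeasure r j) (shellMeasure r (j + (n + 2 : ℕ))) :=
          ENNReal.tsum_le_tsum fun j => gagMeasure_shell_le hu hr j (by omega)
      _ ≤ 16 * ENNReal.ofReal (1 / 2) ^ (n + 2) *
            (6 * ENNReal.ofReal (3 / 2) ^ (n + 2) * (5 * G)) := by
          rw [ENNReal.tsum_mul_left]
          gcongr
          exact le_self_add.trans ((tsum_meanSqDiff_le hu hr (n + 1)).trans (by gcongr))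
      _ = 480 * (ENNReal.ofReal (1 / 2) * ENNReal.ofReal (3 / 2)) ^ (n + 2) * G := by
          rw [mul_pow]; ring
      _ = _ := by
          rw [← ENNReal.ofReal_mul (by norm_num), ← ENNReal.ofReal_pow (by norm_num),
            show (480 : ℝ≥0∞) = ENNReal.ofReal 480 by simp, ← ENNReal.ofReal_mul (by norm_num)]
          norm_num

lemma gagE_univ_le {u : ℝ → ℝ} (hu : Measurable u) {r : ℝ} (hr : 0 < r) :
    gagE univ u ≤ ENNReal.ofReal 3840 * ∑' j : ℤ, gagE (annr r j) u := by
  set T : ℤ → ℝ≥0∞ := fun m => ∑' j : ℤ, gagMeasure u (shell r j ×ˢ shell r (j + m)) with hT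
  have hneg : ∀ m, T (-m) = T m := by
    intro m
    simp only [hT]
    rw [← (Equiv.addRight m).tsum_eq]
    refine tsum_congr fun j => ?_
    rw [Equiv.coe_addRight, add_neg_cancel_right]
    exact gagMeasure_prod_comm hu (measurableSet_shell r _) (measurableSet_shell r _)
  have huniv : gagE univ u = ∑' m, T m := by
    rw [gagE_eq_gagMeasure hu .univ, univ_prod_univ, gagMeasure_univ hr,
      ENNReal.tsum_prod (f := fun j k => gagMeasure u (shell r j ×ˢ shell r k))]
    refine Eq.trans (tsum_congr fun j => ?_) ENNReal.tsum_comm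
    exact ((Equiv.addLeft j).tsum_eq fun k => gagMeasure u (shell r j ×ˢ shell r k)).symm
  have hgeom : ∑' n : ℕ, ENNReal.ofReal (480 * (3 / 4) ^ n) = ENNReal.ofReal 1920 := by
    rw [← ENNReal.ofReal_tsum_of_nonneg (fun n => by positivity)
      ((summable_geometric_of_lt_one (by norm_num) (by norm_num)).mul_left _), tsum_mul_left,
      tsum_geometric_of_lt_one (by norm_num) (by norm_num)]
    norm_num
  have hnat : ∑' n : ℕ, T n ≤ ENNReal.ofReal 1920 * ∑' j : ℤ, gagE (annr r j) u := by
    rw [← hgeom, ← ENNReal.tsum_mul_right]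
    exact ENNReal.tsum_le_tsum fun n => tsum_gagMeasure_shell_le hu hr n
  have hnat' : ∑' n : ℕ, T (-(n + 1 : ℤ)) ≤ ∑' n : ℕ, T n := by
    simp_rw [hneg]
    exact_mod_cast ENNReal.tsum_comp_le_tsum_of_injective (add_left_injective 1)
      fun n : ℕ => T n
  rw [huniv, tsum_of_nat_of_neg_add_one ENNReal.summable ENNReal.summable]
  calc _ ≤ _ := add_le_add hnat (hnat'.trans hnat)
    _ = _ := by
      rw [← add_mul, ← ENNReal.ofReal_add (by norm_num) (by norm_num)]
      norm_num

/-- Localization of the `Ḣ^{1/2}(ℝ)` norm on dyadic annuli of scale `r`, with constants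
independent of `r`: `c ∑_{j∈ℤ} ‖u‖²_{Ḣ^{1/2}(A_j^r)} ≤ ‖u‖²_{Ḣ^{1/2}(ℝ)} ≤
C ∑_{j∈ℤ} ‖u‖²_{Ḣ^{1/2}(A_j^r)}`. -/
theorem statement10 :
    ∃ c C : ℝ, 0 < c ∧ 0 < C ∧
      ∀ r : ℝ, 0 < r →
        ∀ u : ℝ → ℝ,
          MeasureTheory.LocallyIntegrable u volume →
          gagE Set.univ u < ⊤ →
          ENNReal.ofReal c * (∑' j : ℤ, gagE (annr r j) u) ≤ gagE Set.univ u ∧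
            gagE Set.univ u ≤ ENNReal.ofReal C * ∑' j : ℤ, gagE (annr r j) u := by
  refine ⟨1 / 2, 3840, by norm_num, by norm_num, fun r hr u hu _ => ?_⟩
  obtain ⟨v, hv, huv⟩ := hu.aestronglyMeasurable.aemeasurable
  simp_rw [gagE_congr_ae huv]
  refine ⟨?_, gagE_univ_le hv hr⟩
  calc _ ≤ ENNReal.ofReal (1 / 2) * (2 * gagE univ v) := by
        gcongr
        exact tsum_gagE_annr_le hv hr
    _ = gagE univ v := by
        rw [← mul_assoc, show (2 : ℝ≥0∞) = ENNReal.ofReal 2 by simp,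
          ← ENNReal.ofReal_mul (by norm_num)]
        norm_num
end
end

section
/- Let (a_k)_{k∈ℤ} be a sequence of nonnegative real numbers with Σ_{k∈ℤ} a_k² < ∞, and suppose there is C > 0 such that for every integer n ≤ 0, Σ_{k ≤ n} a_k² ≤ C · Σ_{k ≥ n+1} 2^{(n+1−k)/2} a_k². Then there exist β ∈ (0,1), C' > 0 and an integer n̄ < 0 such that for every n ≤ n̄, Σ_{k ≤ n} a_k² ≤ C' · (2^n)^β. -/
/-- The contribution of the indices above `n`, damped geometrically, is summable. -/
lemma summable_damped_tail {b : ℤ → ℝ} (hb : ∀ k, 0 ≤ b k) (hs : Summable b) (n : ℤ) :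
    Summable ({k : ℤ | n + 1 ≤ k}.indicator
      fun k => (2 : ℝ) ^ (((n + 1 - k : ℤ) : ℝ) / 2) * b k) := by
  refine Summable.of_nonneg_of_le (fun k => ?_) (fun k => ?_) hs
  · exact Set.indicator_nonneg (fun k _ => mul_nonneg (by positivity) (hb k)) k
  · refine Set.indicator_le' (fun k hk => ?_) (fun k _ => hb k) k
    have hk' : ((n + 1 - k : ℤ) : ℝ) ≤ 0 := by
      have h : n + 1 - k ≤ 0 := by simp only [Set.mem_ofPred_eq] at hk; omega
      exact_mod_cast h
    exact mul_le_of_le_one_left (hb k)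
      (Real.rpow_le_one_of_one_le_of_nonpos (by norm_num) (by linarith))

/-- Moving the cut from `n` to `n - 1` multiplies the damped part by `2 ^ (-1/2)` and leaves the
undamped part unchanged in the total. -/
lemma tsum_add_tsum_damped_pred {b : ℤ → ℝ} (hb : ∀ k, 0 ≤ b k) (hs : Summable b) (n : ℤ) :
    (∑' k : {k : ℤ // k ≤ n - 1}, b k) +
        ∑' k : {k : ℤ // n - 1 + 1 ≤ k}, (2 : ℝ) ^ (((n - 1 + 1 - (k : ℤ) : ℤ) : ℝ) / 2) * b k =
      (∑' k : {k : ℤ // k ≤ n}, b k) + (2 : ℝ) ^ (-(1 / 2) : ℝ) *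
        ∑' k : {k : ℤ // n + 1 ≤ k}, (2 : ℝ) ^ (((n + 1 - (k : ℤ) : ℤ) : ℝ) / 2) * b k := by
  have hA (m : ℤ) : (∑' k : {k : ℤ // k ≤ m}, b k) = ∑' k, {k : ℤ | k ≤ m}.indicator b k :=
    tsum_subtype {k : ℤ | k ≤ m} b
  have hB (m : ℤ) :
      (∑' k : {k : ℤ // m + 1 ≤ k}, (2 : ℝ) ^ (((m + 1 - (k : ℤ) : ℤ) : ℝ) / 2) * b k) =
        ∑' k, {k : ℤ | m + 1 ≤ k}.indicator
          (fun k => (2 : ℝ) ^ (((m + 1 - k : ℤ) : ℝ) / 2) * b k) k :=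
    tsum_subtype {k : ℤ | m + 1 ≤ k} fun k => (2 : ℝ) ^ (((m + 1 - k : ℤ) : ℝ) / 2) * b k
  rw [hA, hA, hB, hB, ← tsum_mul_left,
    ← (hs.indicator _).tsum_add (summable_damped_tail hb hs (n - 1)),
    ← (hs.indicator _).tsum_add ((summable_damped_tail hb hs n).mul_left _)]
  refine tsum_congr fun k => ?_
  simp only [Set.indicator_apply, Set.mem_ofPred_eq]
  rcases lt_trichotomy k n with h | rfl | h
  · simp [show k ≤ n - 1 by omega, show ¬ n ≤ k by omega, show k ≤ n by omega,
      show ¬ n + 1 ≤ k by omega]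
  · simp
  · rw [if_neg (by omega), if_pos (by omega), if_neg (by omega), if_pos (by omega), ← mul_assoc,
      ← Real.rpow_add (by norm_num)]
    congr 3
    push_cast
    ring

theorem statement13 (a : ℤ → ℝ) (ha : ∀ k, 0 ≤ a k)
    (hsum : Summable fun k : ℤ => a k ^ 2)
    (C : ℝ) (hC : 0 < C)
    (hrec : ∀ n : ℤ, n ≤ 0 →
      (∑' k : {k : ℤ // k ≤ n}, a k ^ 2)
        ≤ C * ∑' k : {k : ℤ // n + 1 ≤ k}, (2 : ℝ) ^ ((((n + 1 - (k : ℤ) : ℤ)) : ℝ) / 2) * a k ^ 2) :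
    ∃ β : ℝ, 0 < β ∧ β < 1 ∧
      ∃ C' : ℝ, 0 < C' ∧
        ∃ nbar : ℤ, nbar < 0 ∧
          ∀ n : ℤ, n ≤ nbar →
            (∑' k : {k : ℤ // k ≤ n}, a k ^ 2) ≤ C' * ((2 : ℝ) ^ n) ^ β := by
  have hstep := tsum_add_tsum_damped_pred (fun k => sq_nonneg (a k)) hsum
  have hA0 (n : ℤ) : 0 ≤ ∑' k : {k : ℤ // k ≤ n}, a k ^ 2 := tsum_nonneg fun k => sq_nonneg _
  have hB0 (n : ℤ) : 0 ≤ ∑' k : {k : ℤ // n + 1 ≤ k},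
      (2 : ℝ) ^ ((((n + 1 - (k : ℤ) : ℤ)) : ℝ) / 2) * a k ^ 2 :=
    tsum_nonneg fun k => by positivity
  generalize hA : (fun n : ℤ => ∑' k : {k : ℤ // k ≤ n}, a k ^ 2) = A
  generalize hB : (fun n : ℤ => ∑' k : {k : ℤ // n + 1 ≤ k},
    (2 : ℝ) ^ ((((n + 1 - (k : ℤ) : ℤ)) : ℝ) / 2) * a k ^ 2) = B
  replace hA (n : ℤ) : (∑' k : {k : ℤ // k ≤ n}, a k ^ 2) = A n := congrFun hA n
  replace hB (n : ℤ) : (∑' k : {k : ℤ // n + 1 ≤ k},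
    (2 : ℝ) ^ ((((n + 1 - (k : ℤ) : ℤ)) : ℝ) / 2) * a k ^ 2) = B n := congrFun hB n
  simp only [hA, hB] at hstep hrec hA0 hB0 ⊢
  set ρ : ℝ := (2 : ℝ) ^ (-(1 / 2) : ℝ) with hρ
  have hρ1 : ρ < 1 := Real.rpow_lt_one_of_one_lt_of_neg (by norm_num) (by norm_num)
  have hρ2 : 1 / 2 < ρ := by
    have h : (2 : ℝ) ^ (-1 : ℝ) < ρ :=
      Real.rpow_lt_rpow_of_exponent_lt (by norm_num) (by norm_num)
    rw [Real.rpow_neg_one] at h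
    linarith
  obtain ⟨δ, hδ⟩ : ∃ δ, δ * (1 + C) = 1 - ρ := ⟨(1 - ρ) / (1 + C), by field_simp⟩
  have hδ0 : 0 < δ := by
    by_contra! h
    nlinarith
  have hδ1 : δ < 1 / 2 := by nlinarith
  have hθ : 0 < 1 - δ := by linarith
  have hcontr (n : ℤ) (hn : n ≤ 0) : A (n - 1) + B (n - 1) ≤ (1 - δ) * (A n + B n) := by
    have h := mul_le_mul_of_nonneg_left (hrec n hn) hδ0.le
    have h' : δ * (C * B n) + δ * B n = (1 - ρ) * B n := by rw [← hδ]; ring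
    rw [hstep]
    linarith
  have hiter (m : ℕ) : A (-m) + B (-m) ≤ (1 - δ) ^ m * (A 0 + B 0) := by
    induction m with
    | zero => simp
    | succ m ih =>
      have h := hcontr (-m) (by omega)
      rw [show (-((m + 1 : ℕ) : ℤ)) = -m - 1 by push_cast; ring]
      calc _ ≤ _ := h
        _ ≤ (1 - δ) * ((1 - δ) ^ m * (A 0 + B 0)) := mul_le_mul_of_nonneg_left ih hθ.le
        _ = _ := by ring
  have hpow : (2 : ℝ) ^ Real.logb 2 (1 - δ) = 1 - δ :=
    Real.rpow_logb (by norm_num) (by norm_num) hθ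
  refine ⟨-Real.logb 2 (1 - δ), ?_, ?_, A 0 + B 0 + 1, by linarith [hA0 0, hB0 0], -1,
    by norm_num, fun n hn => ?_⟩
  · exact neg_pos.2 (Real.logb_neg (by norm_num) hθ (by linarith))
  · have h : -1 < Real.logb 2 (1 - δ) := by
      rw [Real.lt_logb_iff_rpow_lt (by norm_num) hθ, Real.rpow_neg_one]
      linarith
    linarith
  · obtain ⟨m, rfl⟩ : ∃ m : ℕ, n = -m := ⟨n.natAbs, by omega⟩
    have hval : ((2 : ℝ) ^ (-m : ℤ)) ^ (-Real.logb 2 (1 - δ)) = (1 - δ) ^ m := by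
      rw [← Real.rpow_intCast, ← Real.rpow_mul (by norm_num)]
      push_cast
      rw [neg_mul_neg, mul_comm, Real.rpow_mul (by norm_num), hpow, Real.rpow_natCast]
    rw [hval]
    nlinarith [hiter m, hB0 (-m), pow_pos hθ m]
end
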